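/- There exist uncountably many pairwise distinct almost nilpotent varieties of nonassociative algebras over a field of characteristic zero, each of at most quadratic codimension growth; moreover there exist countably many almost nilpotent varieties of at most linear growth. -/

import Mathlib

noncomputable section

/-- Number of occurrences of the variable `i` in a magma word over `ℕ`. -/
def occ : FreeMagma ℕ → ℕ → ℕ
  | .of j, i => if j = i then 1 else 0
  | .mul x y, i => occ x i + occ y i

variable (F : Type) [Field F] [CharZero F]

/-- The free nonassociative algebra on countably many variables. -/
abbrev FreeN := FreeNonUnitalNonAssocAlgebra F ℕ

/-- The monomial corresponding to a magma word. -/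
def monoN (t : FreeMagma ℕ) : FreeN F := MonoidAlgebra.single t (1 : F)

/-- `P_n`: the multilinear polynomials in `x₀, …, x_{n-1}`. -/
def Pmulti (n : ℕ) : Submodule F (FreeN F) :=
  Submodule.span F {x : FreeN F | ∃ t : FreeMagma ℕ,
    (∀ i : ℕ, occ t i = if i < n then 1 else 0) ∧ x = monoN F t}

/-- A T-ideal of the free nonassociative algebra: an ideal stable under all
substitution endomorphisms.  In characteristic zero, varieties of (not necessarily
associative) algebras correspond bijectively (and contravariantly) to T-ideals of
identities. -/
structure TIdeal : Type 1 where
  carrier : Submodule F (FreeN F)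
  mul_mem_left : ∀ (x : FreeN F) {y : FreeN F}, y ∈ carrier → x * y ∈ carrier
  mul_mem_right : ∀ {x : FreeN F} (y : FreeN F), x ∈ carrier → x * y ∈ carrier
  subst_mem : ∀ (φ : ℕ → FreeN F) {f : FreeN F}, f ∈ carrier →
    FreeNonUnitalNonAssocAlgebra.lift F φ f ∈ carrier

/-- The `n`-th codimension of the variety with T-ideal of identities `S`. -/
def codimV (S : TIdeal F) (n : ℕ) : ℕ :=
  Module.finrank F (↥(Pmulti F n) ⧸ Submodule.comap (Pmulti F n).subtype S.carrier)

/-- The variety with identities `S` is nilpotent iff all multilinear polynomials of some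
degree `n` are identities, i.e. `c_n = 0`. -/
def IsNilpotentVariety (S : TIdeal F) : Prop :=
  ∃ n : ℕ, 1 ≤ n ∧ Pmulti F n ≤ S.carrier

/-- Almost nilpotent: not nilpotent, but every proper subvariety (equivalently, every
strictly larger T-ideal) is nilpotent. -/
def IsAlmostNilpotentVariety (S : TIdeal F) : Prop :=
  ¬ IsNilpotentVariety F S ∧
    ∀ S' : TIdeal F, S.carrier < S'.carrier → IsNilpotentVariety F S'

set_option linter.unusedSectionVars false

/-- The algebra attached to a binary word `w`. -/
def AW (_w : ℕ → Bool) (F : Type) : Type := F × (ℕ → F)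

namespace AW

variable {F}
variable {w : ℕ → Bool}

instance : AddCommGroup (AW w F) := inferInstanceAs (AddCommGroup (F × (ℕ → F)))
instance : Module F (AW w F) := inferInstanceAs (Module F (F × (ℕ → F)))

/-- scalar component -/
def c1 : AW w F →ₗ[F] F := LinearMap.fst F F (ℕ → F)
/-- function component -/
def c2 : AW w F →ₗ[F] (ℕ → F) := LinearMap.snd F F (ℕ → F)

theorem ext' {a b : AW w F} (h1 : c1 a = c1 b) (h2 : ∀ k, c2 a k = c2 b k) : a = b :=
  Prod.ext h1 (funext h2)

instance : Mul (AW w F) :=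
  ⟨fun a b => ((0 : F), fun k => if w k then c1 a * c2 b (k+1) else c1 b * c2 a (k+1))⟩

@[simp] theorem c1_mul (a b : AW w F) : c1 (a * b) = 0 := rfl
@[simp] theorem c2_mul (a b : AW w F) (k : ℕ) :
    c2 (a * b) k = if w k then c1 a * c2 b (k+1) else c1 b * c2 a (k+1) := rfl

instance : NonUnitalNonAssocRing (AW w F) :=
  { (inferInstance : AddCommGroup (AW w F)), (inferInstance : Mul (AW w F)) with
    left_distrib := fun a b c => by
      apply ext'
      · simp
      · intro k; simp; split_ifs <;> ring
    right_distrib := fun a b c => by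
      apply ext'
      · simp
      · intro k; simp; split_ifs <;> ring
    zero_mul := fun a => by
      apply ext'
      · simp
      · intro k; simp
    mul_zero := fun a => by
      apply ext'
      · simp
      · intro k; simp }

instance : IsScalarTower F (AW w F) (AW w F) := ⟨fun r a b => by
  apply ext'
  · simp
  · intro k; simp; split_ifs <;> ring⟩

instance : SMulCommClass F (AW w F) (AW w F) := ⟨fun r a b => by
  apply ext'
  · simp
  · intro k; simp; split_ifs <;> ring⟩

end AW

open AW

variable {F}

/-- evaluation of a word in the algebra -/
def ev {w : ℕ → Bool} (φ : ℕ → AW w F) (t : FreeMagma ℕ) : AW w F :=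
  FreeNonUnitalNonAssocAlgebra.lift F φ (monoN F t)

theorem ev_of {w : ℕ → Bool} (φ : ℕ → AW w F) (i : ℕ) : ev φ (FreeMagma.of i) = φ i :=
  FreeNonUnitalNonAssocAlgebra.lift_of_apply F φ i

theorem ev_mul {w : ℕ → Bool} (φ : ℕ → AW w F) (x y : FreeMagma ℕ) :
    ev φ (x * y) = ev φ x * ev φ y := by
  unfold ev
  rw [← map_mul]
  congr 1
  simp [monoN, MonoidAlgebra.single_mul_single]

theorem ev_c1 {w : ℕ → Bool} (φ : ℕ → AW w F) (t : FreeMagma ℕ) (h : 2 ≤ t.length) :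
    c1 (ev φ t) = 0 := by
  induction t using FreeMagma.recOnMul with
  | ih1 i => simp [FreeMagma.length] at h
  | ih2 x y _ _ => rw [ev_mul]; rfl

theorem len_mul (x y : FreeMagma ℕ) : (x * y).length = x.length + y.length := rfl

theorem eq_of_of_c1 {w : ℕ → Bool} {φ : ℕ → AW w F} {t : FreeMagma ℕ} (h : c1 (ev φ t) ≠ 0) :
    ∃ i, t = FreeMagma.of i := by
  induction t using FreeMagma.recOnMul with
  | ih1 i => exact ⟨i, rfl⟩
  | ih2 x y _ _ => rw [ev_mul] at h; exact absurd rfl h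

/-- identities of the algebra -/
def Sw (F : Type) [Field F] [CharZero F] (w : ℕ → Bool) : TIdeal F where
  carrier :=
    { carrier := {f | ∀ φ : ℕ → AW w F, FreeNonUnitalNonAssocAlgebra.lift F φ f = 0}
      add_mem' := fun {a b} ha hb φ => by rw [map_add, ha, hb, add_zero]
      zero_mem' := fun φ => map_zero _
      smul_mem' := fun r a ha φ => by rw [map_smul, ha, smul_zero] }
  mul_mem_left := fun x y hy φ => by rw [map_mul, hy φ, mul_zero]
  mul_mem_right := fun {x} y hx φ => by rw [map_mul, hx φ, zero_mul]
  subst_mem := fun ψ f hf φ => by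
    have key : (FreeNonUnitalNonAssocAlgebra.lift F φ).comp (FreeNonUnitalNonAssocAlgebra.lift F ψ)
        = FreeNonUnitalNonAssocAlgebra.lift F
            (fun i => FreeNonUnitalNonAssocAlgebra.lift F φ (ψ i)) := by
      apply FreeNonUnitalNonAssocAlgebra.hom_ext
      intro x
      simp
    have := DFunLike.congr_fun key f
    rw [NonUnitalAlgHom.comp_apply] at this
    rw [this]
    exact hf _

theorem mem_Sw {w : ℕ → Bool} {f : FreeN F} : f ∈ (Sw F w).carrier ↔
    ∀ φ : ℕ → AW w F, FreeNonUnitalNonAssocAlgebra.lift F φ f = 0 := Iff.rfl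

/-! ### lengths -/

theorem occ_mul (x y : FreeMagma ℕ) (i : ℕ) : occ (x * y) i = occ x i + occ y i := rfl
theorem occ_of (j i : ℕ) : occ (FreeMagma.of j) i = if j = i then 1 else 0 := rfl

theorem sum_occ (s : Finset ℕ) (t : FreeMagma ℕ) (h : ∀ i, i ∉ s → occ t i = 0) :
    ∑ i ∈ s, occ t i = t.length := by
  induction t using FreeMagma.recOnMul with
  | ih1 j =>
    have hj : j ∈ s := by
      by_contra hj
      simpa [occ_of] using h j hj
    simp [occ_of, hj, FreeMagma.length]
  | ih2 x y hx hy =>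
    simp only [occ_mul, Finset.sum_add_distrib, len_mul]
    rw [hx, hy]
    · intro i hi; have := h i hi; rw [occ_mul] at this; omega
    · intro i hi; have := h i hi; rw [occ_mul] at this; omega

theorem len_of_occ {s : Finset ℕ} {t : FreeMagma ℕ} (h : ∀ i, occ t i = if i ∈ s then 1 else 0) :
    t.length = s.card := by
  rw [← sum_occ s t (fun i hi => by rw [h, if_neg hi])]
  rw [Finset.sum_congr rfl (fun i hi => by rw [h, if_pos hi])]
  simp

theorem finite_words (N n : ℕ) :
    {t : FreeMagma ℕ | t.length ≤ n ∧ ∀ i, N ≤ i → occ t i = 0}.Finite := by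
  induction n with
  | zero =>
    convert Set.finite_empty
    ext t
    simp only [Set.mem_ofPred_eq, Set.mem_empty_iff_false, iff_false]
    have := t.length_pos
    omega
  | succ n ih =>
    refine ((((Set.finite_Iio N).image FreeMagma.of)).union (Set.Finite.image2 (· * ·) ih ih)).subset ?_
    rintro t ⟨h1, h2⟩
    induction t using FreeMagma.recOnMul with
    | ih1 j =>
      left
      refine ⟨j, ?_, rfl⟩
      by_contra hj
      simp only [Set.mem_Iio, not_lt] at hj
      simpa [occ_of] using h2 j hj
    | ih2 x y _ _ =>
      right
      rw [len_mul] at h1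
      have := x.length_pos
      have := y.length_pos
      refine ⟨x, ⟨by omega, ?_⟩, y, ⟨by omega, ?_⟩, rfl⟩
      · intro i hi; have := h2 i hi; rw [occ_mul] at this; omega
      · intro i hi; have := h2 i hi; rw [occ_mul] at this; omega

theorem len_of_occ' {n : ℕ} {t : FreeMagma ℕ} (h : ∀ i, occ t i = if i < n then 1 else 0) :
    t.length = n := by
  simpa using len_of_occ (s := Finset.range n) (t := t) (by simpa using h)

theorem Pmulti_fg (n : ℕ) : (Pmulti F n).FG := by
  apply Submodule.fg_span
  refine ((finite_words n n).image (monoN F)).subset ?_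
  rintro x ⟨t, ht, rfl⟩
  refine ⟨t, ⟨(len_of_occ' ht).le, ?_⟩, rfl⟩
  intro i hi
  rw [ht, if_neg (by omega)]

/-- Every non-nilpotent variety contains an almost nilpotent one. -/
theorem exists_almost (S : TIdeal F) (hS : ¬ IsNilpotentVariety F S) :
    ∃ T : TIdeal F, S.carrier ≤ T.carrier ∧ IsAlmostNilpotentVariety F T := by
  obtain ⟨m, hm, hmax⟩ := zorn_le_nonempty₀
    {p : Submodule F (FreeN F) | ∃ T : TIdeal F, T.carrier = p ∧ ¬ IsNilpotentVariety F T}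
    (by
      intro c hc hchain y hy
      have hne : c.Nonempty := ⟨y, hy⟩
      have hdir : DirectedOn (· ≤ ·) c := hchain.directedOn
      have hmem : ∀ z, z ∈ sSup c ↔ ∃ p ∈ c, z ∈ p := fun z =>
        Submodule.mem_sSup_of_directed hne hdir
      refine ⟨sSup c, ⟨⟨sSup c, ?_, ?_, ?_⟩, rfl, ?_⟩, fun z hz => le_sSup hz⟩
      · intro x y hy
        rw [hmem] at hy ⊢
        obtain ⟨p, hp, hyp⟩ := hy
        obtain ⟨T, rfl, _⟩ := hc hp
        exact ⟨_, hp, T.mul_mem_left x hyp⟩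
      · intro x y hy
        rw [hmem] at hy ⊢
        obtain ⟨p, hp, hyp⟩ := hy
        obtain ⟨T, rfl, _⟩ := hc hp
        exact ⟨_, hp, T.mul_mem_right y hyp⟩
      · intro φ x hy
        rw [hmem] at hy ⊢
        obtain ⟨p, hp, hyp⟩ := hy
        obtain ⟨T, rfl, _⟩ := hc hp
        exact ⟨_, hp, T.subst_mem φ hyp⟩
      · rintro ⟨n, hn, hle⟩
        have hcomp := (Submodule.fg_iff_compact _).1 (Pmulti_fg (F := F) n)
        obtain ⟨p, hp, hpn⟩ :=
          (CompleteLattice.isCompactElement_iff_le_of_directed_sSup_le _ _).1 hcomp c hne hdir hle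
        obtain ⟨T, rfl, hT⟩ := hc hp
        exact hT ⟨n, hn, hpn⟩)
    S.carrier ⟨S, rfl, hS⟩
  obtain ⟨T, rfl, hT⟩ := hmax.1
  refine ⟨T, hm, hT, fun S' hS' => ?_⟩
  by_contra hnil
  exact absurd (hmax.2 ⟨S', rfl, hnil⟩ hS'.le) (not_le_of_gt hS')

/-! ### non-nilpotency -/

/-- substitution `x_i ↦` constant function, `x_j ↦` the operator element -/
def phi0 (F : Type) [Field F] [CharZero F] (w : ℕ → Bool) (i : ℕ) : ℕ → AW w F := fun j =>
  (if j = i then (0 : F) else 1, fun _ => if j = i then (1 : F) else 0)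

theorem phi0_c1 (w : ℕ → Bool) (i j : ℕ) : c1 (phi0 F w i j) = if j = i then 0 else 1 := rfl

theorem phi0_c2 (w : ℕ → Bool) (i j k : ℕ) : c2 (phi0 F w i j) k = if j = i then 1 else 0 := rfl

/-- the monomial following the word `w` from position `k` -/
def comb (w : ℕ → Bool) : ℕ → ℕ → FreeMagma ℕ
  | 0, _ => FreeMagma.of 0
  | n+1, k => if w k then FreeMagma.of (n+1) * comb w n (k+1) else comb w n (k+1) * FreeMagma.of (n+1)

theorem occ_comb (w : ℕ → Bool) (n k i : ℕ) :
    occ (comb w n k) i = if i < n + 1 then 1 else 0 := by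
  induction n generalizing k with
  | zero => simp only [comb, occ_of]; congr 1; simp; omega
  | succ n ih =>
    simp only [comb]
    split_ifs with h1 h2 <;> rw [occ_mul, ih, occ_of] <;> split_ifs <;> omega

theorem ev_comb (w : ℕ → Bool) (n k : ℕ) : c2 (ev (phi0 F w 0) (comb w n k)) k = 1 := by
  suffices h : ∀ m k, c2 (ev (phi0 F w 0) (comb w m k)) k = 1 from h n k
  intro m
  induction m with
  | zero => intro k; simp [comb, ev_of, phi0_c2]
  | succ n ih =>
    intro k
    simp only [comb]
    split_ifs with h1 <;> simp [ev_mul, h1, ev_of, phi0_c1, ih]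

theorem Sw_not_nilp (w : ℕ → Bool) : ¬ IsNilpotentVariety F (Sw F w) := by
  rintro ⟨n, hn, hle⟩
  obtain ⟨n, rfl⟩ : ∃ m, n = m + 1 := ⟨n - 1, by omega⟩
  have h1 : monoN F (comb w n 0) ∈ Pmulti F (n+1) :=
    Submodule.subset_span ⟨_, fun i => occ_comb w n 0 i, rfl⟩
  have h2 := mem_Sw.1 (hle h1) (phi0 F w 0)
  have h3 := ev_comb (F := F) w n 0
  unfold ev at h3
  rw [h2] at h3
  simp at h3

/-! ### separation -/

theorem match_words {w w' : ℕ → Bool} {φ : ℕ → AW w F} {φ' : ℕ → AW w' F} (t : FreeMagma ℕ) :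
    ∀ k k', c2 (ev φ t) k ≠ 0 → c2 (ev φ' t) k' ≠ 0 →
      ∀ j, j + 2 < t.length → w (k + j) = w' (k' + j) := by
  induction t using FreeMagma.recOnMul with
  | ih1 i => intro k k' _ _ j hj; simp [FreeMagma.length] at hj
  | ih2 x y hx hy =>
    intro k k' h h' j hj
    rw [ev_mul, c2_mul] at h h'
    rw [len_mul] at hj
    by_cases hw : w k = true <;> by_cases hw' : w' k' = true <;> simp only [hw, hw', if_true] at h h'
    · obtain ⟨i, rfl⟩ := eq_of_of_c1 (left_ne_zero_of_mul h)
      cases j with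
      | zero => simp [hw, hw']
      | succ j =>
        have := hy (k+1) (k'+1) (right_ne_zero_of_mul h) (right_ne_zero_of_mul h') j
          (by simp [FreeMagma.length] at hj; omega)
        rwa [Nat.add_right_comm, Nat.add_right_comm k'] at this
    · obtain ⟨i, rfl⟩ := eq_of_of_c1 (left_ne_zero_of_mul h)
      obtain ⟨i', rfl⟩ := eq_of_of_c1 (left_ne_zero_of_mul h')
      simp [FreeMagma.length] at hj
    · obtain ⟨i, rfl⟩ := eq_of_of_c1 (left_ne_zero_of_mul h)
      obtain ⟨i', rfl⟩ := eq_of_of_c1 (left_ne_zero_of_mul h')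
      simp [FreeMagma.length] at hj
    · obtain ⟨i, rfl⟩ := eq_of_of_c1 (left_ne_zero_of_mul h)
      cases j with
      | zero => simp [hw, hw']
      | succ j =>
        have := hx (k+1) (k'+1) (right_ne_zero_of_mul h) (right_ne_zero_of_mul h') j
          (by simp [FreeMagma.length] at hj; omega)
        rwa [Nat.add_right_comm, Nat.add_right_comm k'] at this

theorem exists_of_not_mem {w : ℕ → Bool} {t : FreeMagma ℕ} (h2 : 2 ≤ t.length)
    (h : monoN F t ∉ (Sw F w).carrier) : ∃ (φ : ℕ → AW w F) (k : ℕ), c2 (ev φ t) k ≠ 0 := by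
  by_contra! hcon
  apply h
  intro φ
  apply ext'
  · rw [map_zero]; exact ev_c1 φ t h2
  · intro k; rw [map_zero]; exact hcon φ k

theorem separation {w w' : ℕ → Bool} {m : ℕ}
    (h : ∀ k k', ∃ j < m, w (k + j) ≠ w' (k' + j)) (T : TIdeal F)
    (h1 : (Sw F w).carrier ≤ T.carrier) (h2 : (Sw F w').carrier ≤ T.carrier) :
    IsNilpotentVariety F T := by
  refine ⟨m + 2, by omega, Submodule.span_le.2 ?_⟩
  rintro x ⟨t, ht, rfl⟩
  have hl := len_of_occ' ht
  by_contra hx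
  obtain ⟨φ, k, hk⟩ := exists_of_not_mem (w := w) (by omega) (fun hh => hx (h1 hh))
  obtain ⟨φ', k', hk'⟩ := exists_of_not_mem (w := w') (by omega) (fun hh => hx (h2 hh))
  obtain ⟨j, hj, hne⟩ := h k k'
  exact hne (match_words t k k' hk hk' j (by omega))

/-! ### codimension bound -/

theorem occ_split {x y : FreeMagma ℕ} {s : Finset ℕ} {i0 : ℕ}
    (h : ∀ i, occ (FreeMagma.of i0) i + occ y i = if i ∈ s then 1 else 0) :
    i0 ∈ s ∧ ∀ i, occ y i = if i ∈ s.erase i0 then 1 else 0 := by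
  have h0 := h i0
  rw [occ_of, if_pos rfl] at h0
  have hm : i0 ∈ s := by
    by_contra hm
    rw [if_neg hm] at h0
    omega
  refine ⟨hm, fun i => ?_⟩
  have hi := h i
  rw [occ_of] at hi
  by_cases hii : i0 = i
  · subst hii; simp [hm] at h0 ⊢; exact h0
  · rw [if_neg hii] at hi
    simpa [Finset.mem_erase, Ne.symm hii] using hi

theorem step_formula {w : ℕ → Bool} (φ : ℕ → AW w F) {y : FreeMagma ℕ} {s : Finset ℕ} {i0 : ℕ} (k : ℕ)
    (hm : i0 ∈ s)
    (hy : ∀ k, c2 (ev φ y) k = ∑ i ∈ s.erase i0, c2 (φ i) (k + (s.erase i0).card - 1) *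
        (∏ j ∈ (s.erase i0).erase i, c1 (φ j)) * c2 (ev (phi0 F w i) y) k) :
    c1 (φ i0) * c2 (ev φ y) (k + 1) = ∑ i ∈ s, c2 (φ i) (k + s.card - 1) *
        (∏ j ∈ s.erase i, c1 (φ j)) * (c1 (phi0 F w i i0) * c2 (ev (phi0 F w i) y) (k+1)) := by
  rw [← Finset.add_sum_erase _ _ hm, phi0_c1, if_pos rfl]
  simp only [zero_mul, mul_zero, zero_add]
  rw [hy, Finset.mul_sum]
  apply Finset.sum_congr rfl
  intro i hi
  have hne : i0 ≠ i := fun h => by simp [h] at hi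
  rw [phi0_c1, if_neg hne, Finset.card_erase_of_mem hm]
  have hc : 0 < s.card := Finset.card_pos.2 ⟨_, hm⟩
  have e1 : k + 1 + (s.card - 1) - 1 = k + s.card - 1 := by omega
  have e2 : ∏ j ∈ s.erase i, c1 (φ j) = c1 (φ i0) * ∏ j ∈ (s.erase i0).erase i, c1 (φ j) := by
    rw [Finset.erase_right_comm]
    rw [Finset.mul_prod_erase (s.erase i) (fun j => c1 (φ j)) (Finset.mem_erase.2 ⟨hne, hm⟩)]
  rw [e1, e2]
  ring

theorem ev_formula {w : ℕ → Bool} (φ : ℕ → AW w F) (t : FreeMagma ℕ) :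
    ∀ (s : Finset ℕ) (k : ℕ), (∀ i, occ t i = if i ∈ s then 1 else 0) →
      c2 (ev φ t) k = ∑ i ∈ s, c2 (φ i) (k + s.card - 1) *
        (∏ j ∈ s.erase i, c1 (φ j)) * c2 (ev (phi0 F w i) t) k := by
  induction t using FreeMagma.recOnMul with
  | ih1 i0 =>
    intro s k h
    have hs : s = {i0} := by
      ext i
      have := h i
      rw [occ_of] at this
      rw [Finset.mem_singleton]
      split_ifs at this <;> grind
    subst hs
    simp [ev_of, phi0_c2]
  | ih2 x y hx hy =>
    intro s k h
    simp only [occ_mul] at h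
    simp only [ev_mul, c2_mul]
    by_cases hw : w k = true
    · simp only [hw, if_true]
      by_cases hx1 : ∃ i0, x = FreeMagma.of i0
      · obtain ⟨i0, rfl⟩ := hx1
        obtain ⟨hm, hoc⟩ := occ_split (x := y) h
        simp only [ev_of]
        exact step_formula φ k hm (fun k => hy _ k hoc)
      · have hz : ∀ ψ : ℕ → AW w F, c1 (ev ψ x) = 0 := fun ψ => by
          by_contra hh; exact hx1 (eq_of_of_c1 hh)
        simp [hz]
    · simp only [hw]
      by_cases hy1 : ∃ i0, y = FreeMagma.of i0
      · obtain ⟨i0, rfl⟩ := hy1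
        obtain ⟨hm, hoc⟩ := occ_split (x := x) (y := x) (fun i => by rw [add_comm]; exact h i)
        simp only [ev_of]
        exact step_formula φ k hm (fun k => hx _ k hoc)
      · have hz : ∀ ψ : ℕ → AW w F, c1 (ev ψ y) = 0 := fun ψ => by
          by_contra hh; exact hy1 (eq_of_of_c1 hh)
        simp [hz]

theorem ev_phi0_congr {w : ℕ → Bool} (i : ℕ) (t : FreeMagma ℕ) :
    ∀ k k', (∀ j, j + 1 < t.length → w (k + j) = w (k' + j)) →
      c2 (ev (phi0 F w i) t) k = c2 (ev (phi0 F w i) t) k' := by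
  induction t using FreeMagma.recOnMul with
  | ih1 j => intro k k' _; simp [ev_of, phi0_c2]
  | ih2 x y hx hy =>
    intro k k' h
    rw [len_mul] at h
    have px := x.length_pos
    have py := y.length_pos
    have h0 := h 0 (by omega)
    simp only [add_zero] at h0
    rw [ev_mul, c2_mul, c2_mul, ← h0]
    rw [hx (k+1) (k'+1), hy (k+1) (k'+1)]
    · intro j hj
      have := h (j+1) (by omega)
      rwa [Nat.add_right_comm, Nat.add_right_comm k']
    · intro j hj
      have := h (j+1) (by omega)
      rwa [Nat.add_right_comm, Nat.add_right_comm k']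

/-- the linear functionals detecting identities -/
def Lmap (F : Type) [Field F] [CharZero F] (w : ℕ → Bool) (n N : ℕ) (r : Fin N → ℕ) :
    FreeN F →ₗ[F] (Fin n × Fin N → F) :=
  LinearMap.pi fun q => (LinearMap.proj (r q.2)).comp (c2.comp
    (FreeNonUnitalNonAssocAlgebra.lift F (phi0 F w q.1) : FreeN F →ₗ[F] AW w F))

theorem Lmap_apply (w : ℕ → Bool) (n N : ℕ) (r : Fin N → ℕ) (f : FreeN F) (q : Fin n × Fin N) :
    Lmap F w n N r f q =
      c2 (FreeNonUnitalNonAssocAlgebra.lift F (phi0 F w q.1) f) (r q.2) := rfl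

theorem lift_formula {w : ℕ → Bool} (n : ℕ) (hn : 2 ≤ n) (f : FreeN F) (hf : f ∈ Pmulti F n)
    (φ : ℕ → AW w F) :
    c1 (FreeNonUnitalNonAssocAlgebra.lift F φ f) = 0 ∧
    ∀ k, c2 (FreeNonUnitalNonAssocAlgebra.lift F φ f) k =
      ∑ i ∈ Finset.range n, c2 (φ i) (k + n - 1) *
        (∏ j ∈ (Finset.range n).erase i, c1 (φ j)) *
        c2 (FreeNonUnitalNonAssocAlgebra.lift F (phi0 F w i) f) k := by
  induction hf using Submodule.span_induction with
  | mem x hx =>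
    obtain ⟨t, ht, rfl⟩ := hx
    refine ⟨ev_c1 φ t (by rw [len_of_occ' ht]; exact hn), fun k => ?_⟩
    simpa [ev] using ev_formula φ t (Finset.range n) k (by simpa using ht)
  | zero => simp
  | add x y _ _ hx hy =>
    refine ⟨by rw [map_add, map_add, hx.1, hy.1, add_zero], fun k => ?_⟩
    simp only [map_add, Pi.add_apply, hx.2, hy.2, mul_add, Finset.sum_add_distrib]
  | smul a x _ hx =>
    refine ⟨by rw [map_smul, map_smul, hx.1, smul_zero], fun k => ?_⟩
    simp only [map_smul, Pi.smul_apply, hx.2, smul_eq_mul, Finset.mul_sum]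
    refine Finset.sum_congr rfl fun i _ => by ring

theorem lift_congr {w : ℕ → Bool} (n : ℕ) (f : FreeN F) (hf : f ∈ Pmulti F n)
    (i k k' : ℕ) (h : ∀ j, j + 1 < n → w (k + j) = w (k' + j)) :
    c2 (FreeNonUnitalNonAssocAlgebra.lift F (phi0 F w i) f) k =
      c2 (FreeNonUnitalNonAssocAlgebra.lift F (phi0 F w i) f) k' := by
  induction hf using Submodule.span_induction with
  | mem x hx =>
    obtain ⟨t, ht, rfl⟩ := hx
    exact ev_phi0_congr i t k k' (by rw [len_of_occ' ht]; exact h)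
  | zero => simp
  | add x y _ _ hx hy => simp only [map_add, Pi.add_apply, hx, hy]
  | smul a x _ hx => simp only [map_smul, Pi.smul_apply, hx]

theorem codim_le {w : ℕ → Bool} (n N : ℕ) (hn : 2 ≤ n) (g : ℕ → Fin N)
    (hg : ∀ k k', g k = g k' → ∀ j, j + 1 < n → w (k + j) = w (k' + j))
    (T : TIdeal F) (hT : (Sw F w).carrier ≤ T.carrier) : codimV F T n ≤ n * N := by
  classical
  let r : Fin N → ℕ := Function.invFun g
  have hr : ∀ k, g (r (g k)) = g k := fun k => Function.invFun_eq ⟨k, rfl⟩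
  let L : Pmulti F n →ₗ[F] (Fin n × Fin N → F) := (Lmap F w n N r).comp (Pmulti F n).subtype
  have hker : LinearMap.ker L ≤ Submodule.comap (Pmulti F n).subtype T.carrier := by
    rintro ⟨f, hf⟩ hfL
    apply hT
    have hfL' : Lmap F w n N r f = 0 := hfL
    intro φ
    obtain ⟨a1, a2⟩ := lift_formula n hn f hf φ
    apply ext'
    · rw [map_zero]; exact a1
    · intro k
      rw [map_zero]
      refine (a2 k).trans (Finset.sum_eq_zero fun i hi => ?_)
      have := congrFun hfL' (⟨i, Finset.mem_range.1 hi⟩, g k)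
      rw [Lmap_apply] at this
      rw [lift_congr n f hf i k (r (g k)) (hg _ _ (hr k).symm)]
      simp only at this
      rw [this]
      simp
  have e := LinearMap.quotKerEquivRange L
  have : Module.Finite F (Pmulti F n ⧸ LinearMap.ker L) := Module.Finite.equiv e.symm
  have h1 : codimV F T n ≤ Module.finrank F (Pmulti F n ⧸ LinearMap.ker L) :=
    LinearMap.finrank_le_finrank_of_surjective (f := Submodule.factor hker)
      (Submodule.factor_surjective hker)
  refine h1.trans ?_
  rw [e.finrank_eq]
  refine (Submodule.finrank_le _).trans ?_
  simp

/-! ### Sturmian words -/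

/-- the mechanical word of slope `α` -/
def sw (α : ℝ) (i : ℕ) : Bool := decide (⌊((i : ℝ) + 1) * α⌋ - ⌊(i : ℝ) * α⌋ = 1)

theorem sw_diff {α : ℝ} (h0 : 0 < α) (h1 : α < 1) (i : ℕ) :
    ⌊((i : ℝ) + 1) * α⌋ - ⌊(i : ℝ) * α⌋ = if sw α i then 1 else 0 := by
  have a : ⌊(i : ℝ) * α⌋ ≤ ⌊((i : ℝ) + 1) * α⌋ := Int.floor_le_floor (by nlinarith)
  have b : ⌊((i : ℝ) + 1) * α⌋ < ⌊(i : ℝ) * α⌋ + 2 := by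
    rw [Int.floor_lt]
    push_cast
    have := Int.lt_floor_add_one ((i : ℝ) * α)
    nlinarith
  unfold sw
  simp only [decide_eq_true_eq]
  split_ifs <;> omega

theorem sw_sum {α β : ℝ} (h0 : 0 < α) (h1 : α < 1) (h0' : 0 < β) (h1' : β < 1) (k k' m : ℕ)
    (h : ∀ j < m, sw α (k + j) = sw β (k' + j)) :
    ⌊((k : ℝ) + m) * α⌋ - ⌊(k : ℝ) * α⌋ = ⌊((k' : ℝ) + m) * β⌋ - ⌊(k' : ℝ) * β⌋ := by
  induction m with
  | zero => simp
  | succ m ih =>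
    have := ih (fun j hj => h j (by omega))
    have e1 := sw_diff h0 h1 (k + m)
    have e2 := sw_diff h0' h1' (k' + m)
    rw [h m (by omega), ← e2] at e1
    push_cast at e1 ⊢
    rw [← add_assoc, ← add_assoc]
    omega

theorem sw_sep {α β : ℝ} (h0 : 0 < α) (h1 : α < 1) (h0' : 0 < β) (h1' : β < 1) (hne : α ≠ β) :
    ∃ m, ∀ k k', ∃ j < m, sw α (k + j) ≠ sw β (k' + j) := by
  obtain ⟨m, hm⟩ := exists_nat_gt (2 / |α - β|)
  have hpos : 0 < |α - β| := abs_pos.2 (sub_ne_zero.2 hne)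
  rw [div_lt_iff₀ hpos] at hm
  refine ⟨m, fun k k' => ?_⟩
  by_contra! hcon
  have key := sw_sum h0 h1 h0' h1' k k' m hcon
  have key' : ((⌊((k : ℝ) + m) * α⌋ : ℝ) - ⌊(k : ℝ) * α⌋)
      = (⌊((k' : ℝ) + m) * β⌋ : ℝ) - ⌊(k' : ℝ) * β⌋ := by exact_mod_cast key
  have a1 := Int.floor_le (((k : ℝ) + m) * α)
  have a2 := Int.lt_floor_add_one (((k : ℝ) + m) * α)
  have a3 := Int.floor_le ((k : ℝ) * α)
  have a4 := Int.lt_floor_add_one ((k : ℝ) * α)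
  have b1 := Int.floor_le (((k' : ℝ) + m) * β)
  have b2 := Int.lt_floor_add_one (((k' : ℝ) + m) * β)
  have b3 := Int.floor_le ((k' : ℝ) * β)
  have b4 := Int.lt_floor_add_one ((k' : ℝ) * β)
  rw [← abs_of_nonneg (Nat.cast_nonneg m : (0 : ℝ) ≤ m), ← abs_mul] at hm
  rcases lt_abs.1 hm with h | h <;> linarith

/-- thresholds passed by the phase of `k` -/
def thr (α : ℝ) (m k : ℕ) : Finset ℕ := by
  classical
  exact (Finset.range (m + 1)).filter (fun j => 1 ≤ Int.fract ((k : ℝ) * α) + Int.fract ((j : ℝ) * α))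

theorem mem_thr {α : ℝ} {m k j : ℕ} : j ∈ thr α m k ↔
    j < m + 1 ∧ 1 ≤ Int.fract ((k : ℝ) * α) + Int.fract ((j : ℝ) * α) := by
  simp [thr]

theorem floor_add_thr {α : ℝ} {m k j : ℕ} (hj : j < m + 1) :
    ⌊((k : ℝ) + j) * α⌋ = ⌊(k : ℝ) * α⌋ + ⌊(j : ℝ) * α⌋ + if j ∈ thr α m k then 1 else 0 := by
  rw [Int.floor_eq_iff]
  have a1 := Int.floor_add_fract ((k : ℝ) * α)
  have a2 := Int.floor_add_fract ((j : ℝ) * α)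
  have b1 := Int.fract_nonneg ((k : ℝ) * α)
  have b2 := Int.fract_nonneg ((j : ℝ) * α)
  have c1 := Int.fract_lt_one ((k : ℝ) * α)
  have c2 := Int.fract_lt_one ((j : ℝ) * α)
  by_cases h : j ∈ thr α m k
  · have := (mem_thr.1 h).2
    simp only [h, if_true]
    push_cast
    constructor <;> linarith
  · have : Int.fract ((k : ℝ) * α) + Int.fract ((j : ℝ) * α) < 1 := by
      by_contra hh
      exact h (mem_thr.2 ⟨hj, not_lt.1 hh⟩)
    simp only [h, if_false]
    push_cast
    constructor <;> linarith

theorem thr_eq {α : ℝ} {m k k' : ℕ} (h : (thr α m k).card = (thr α m k').card) :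
    thr α m k = thr α m k' := by
  rcases le_total (Int.fract ((k : ℝ) * α)) (Int.fract ((k' : ℝ) * α)) with hle | hle
  · apply Finset.eq_of_subset_of_card_le _ h.ge
    intro j hj
    rw [mem_thr] at hj ⊢
    exact ⟨hj.1, by linarith⟩
  · symm
    apply Finset.eq_of_subset_of_card_le _ h.le
    intro j hj
    rw [mem_thr] at hj ⊢
    exact ⟨hj.1, by linarith⟩

theorem sw_complexity (α : ℝ) (m : ℕ) : ∃ g : ℕ → Fin (m + 2), ∀ k k', g k = g k' →
    ∀ j, j < m → sw α (k + j) = sw α (k' + j) := by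
  refine ⟨fun k => ⟨(thr α m k).card, ?_⟩, fun k k' h j hj => ?_⟩
  · have : (thr α m k).card ≤ (Finset.range (m+1)).card :=
      Finset.card_le_card (fun j hj => Finset.mem_range.2 (mem_thr.1 hj).1)
    simp at this
    omega
  · have he := thr_eq (Fin.mk.inj_iff.1 h)
    have a1 := floor_add_thr (α := α) (m := m) (k := k) (j := j) (by omega)
    have a2 := floor_add_thr (α := α) (m := m) (k := k') (j := j) (by omega)
    have b1 := floor_add_thr (α := α) (m := m) (k := k) (j := j + 1) (by omega)
    have b2 := floor_add_thr (α := α) (m := m) (k := k') (j := j + 1) (by omega)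
    rw [he] at a1 b1
    unfold sw
    push_cast at a1 a2 b1 b2 ⊢
    rw [add_assoc, add_assoc (k' : ℝ), a1, a2, b1, b2]
    congr 2
    ring

theorem sw_periodic (p : ℕ) (k : ℕ) (hp : 0 < p) :
    sw (1 / (p : ℝ)) k = sw (1 / (p : ℝ)) (k % p) := by
  have hp' : (p : ℝ) ≠ 0 := by positivity
  have key : ∀ c : ℝ, ⌊((k : ℝ) + c) * (1 / (p : ℝ))⌋
      = ⌊(((k % p : ℕ) : ℝ) + c) * (1 / (p : ℝ))⌋ + ((k / p : ℕ) : ℤ) := by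
    intro c
    rw [← Int.floor_add_natCast]
    congr 1
    have : (k : ℝ) = ((k % p : ℕ) : ℝ) + p * ((k / p : ℕ) : ℝ) := by
      exact_mod_cast (Nat.mod_add_div k p).symm
    generalize ((k % p : ℕ) : ℝ) = x at this ⊢
    generalize ((k / p : ℕ) : ℝ) = y at this ⊢
    rw [this]
    field_simp
    ring
  have k0 := key 0
  simp only [add_zero] at k0
  unfold sw
  rw [key 1, k0]
  congr 2
  ring

variable (F)

theorem exists_T (α : ℝ) : ∃ T : TIdeal F, (Sw F (sw α)).carrier ≤ T.carrier ∧
    IsAlmostNilpotentVariety F T := exists_almost _ (Sw_not_nilp _)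

/-- the chosen almost nilpotent variety -/
def TT (α : ℝ) : TIdeal F := (exists_T F α).choose

theorem TT_inj : Set.InjOn (TT F) (Set.Ioo 0 1) := by
  intro α hα β hβ h
  by_contra hne
  obtain ⟨m, hm⟩ := sw_sep hα.1 hα.2 hβ.1 hβ.2 hne
  have h1 := (exists_T F α).choose_spec
  have h2 := (exists_T F β).choose_spec
  have h' : (exists_T F α).choose = (exists_T F β).choose := h
  rw [← h'] at h2
  exact h1.2.1 (separation hm _ h1.1 h2.1)

/-- over any field of characteristic zero there are uncountably many
distinct almost nilpotent varieties of at most quadratic codimension growth, and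
countably (infinitely) many almost nilpotent varieties of at most linear growth. -/
theorem uncountably_many_almost_nilpotent :
    (∃ 𝒮 : Set (TIdeal F), ¬ 𝒮.Countable ∧ ∀ S ∈ 𝒮,
      IsAlmostNilpotentVariety F S ∧
        ∃ C : ℝ, 0 < C ∧ ∀ n : ℕ, 1 ≤ n → (codimV F S n : ℝ) ≤ C * n ^ 2) ∧
    (∃ 𝒯 : Set (TIdeal F), 𝒯.Countable ∧ 𝒯.Infinite ∧ ∀ S ∈ 𝒯,
      IsAlmostNilpotentVariety F S ∧
        ∃ C : ℝ, 0 < C ∧ ∀ n : ℕ, 1 ≤ n → (codimV F S n : ℝ) ≤ C * n) := by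
  refine ⟨⟨TT F '' Set.Ioo 0 1, ?_, ?_⟩,
    ⟨Set.range (fun p : ℕ => TT F (1 / ((p + 2 : ℕ) : ℝ))), Set.countable_range _, ?_, ?_⟩⟩
  · intro hc
    have := Set.countable_of_injective_of_countable_image (TT_inj F) hc
    rw [Cardinal.Real.Ioo_countable_iff] at this
    linarith
  · rintro _ ⟨α, hα, rfl⟩
    refine ⟨(exists_T F α).choose_spec.2, 2 + codimV F (TT F α) 1, by positivity, ?_⟩
    intro n hn
    rcases Nat.lt_or_ge n 2 with h | h
    · obtain rfl : n = 1 := by omega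
      simp
    · have hb : codimV F (TT F α) n ≤ n * (n - 1 + 2) := by
        obtain ⟨g, hg⟩ := sw_complexity α (n - 1)
        exact codim_le (w := sw α) n _ h g (fun k k' hk j hj => hg k k' hk j (by omega)) _
          (exists_T F α).choose_spec.1
      have hb' : (codimV F (TT F α) n : ℝ) ≤ n * (n + 1) := by
        rw [show n - 1 + 2 = n + 1 by omega] at hb
        exact_mod_cast hb
      have hn' : (1 : ℝ) ≤ n := by exact_mod_cast hn
      have : (0 : ℝ) ≤ codimV F (TT F α) 1 := by positivity
      nlinarith [mul_nonneg this (sq_nonneg (n : ℝ))]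
  · apply Set.infinite_range_of_injective
    intro p q hpq
    have hmem : ∀ p : ℕ, (1 / ((p + 2 : ℕ) : ℝ)) ∈ Set.Ioo (0 : ℝ) 1 := by
      intro p
      refine ⟨by positivity, ?_⟩
      rw [div_lt_one (by positivity)]
      push_cast
      have : (0 : ℝ) ≤ p := by positivity
      linarith
    have := TT_inj F (hmem p) (hmem q) hpq
    rw [one_div, one_div, inv_inj] at this
    have : p + 2 = q + 2 := by exact_mod_cast this
    omega
  · rintro _ ⟨p, rfl⟩
    simp only
    set α : ℝ := 1 / ((p + 2 : ℕ) : ℝ) with hα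
    refine ⟨(exists_T F α).choose_spec.2, (p + 2) + codimV F (TT F α) 1, by positivity, ?_⟩
    intro n hn
    rcases Nat.lt_or_ge n 2 with h | h
    · obtain rfl : n = 1 := by omega
      have : (0 : ℝ) ≤ p := by positivity
      simp
      linarith
    · have hb : codimV F (TT F α) n ≤ n * (p + 2) := by
        refine codim_le (w := sw α) n (p + 2) h (fun k => ⟨k % (p + 2), Nat.mod_lt _ (by omega)⟩)
          ?_ _ (exists_T F α).choose_spec.1
        intro k k' hk j _
        have hk' : k % (p + 2) = k' % (p + 2) := Fin.mk.inj_iff.1 hk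
        rw [hα, sw_periodic (p + 2) (k + j) (by omega), sw_periodic (p + 2) (k' + j) (by omega),
          Nat.add_mod, hk', ← Nat.add_mod]
      have hb' : (codimV F (TT F α) n : ℝ) ≤ n * (p + 2) := by exact_mod_cast hb
      have : (0 : ℝ) ≤ codimV F (TT F α) 1 := by positivity
      nlinarith [mul_nonneg this (Nat.cast_nonneg n : (0 : ℝ) ≤ n)]
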